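/- arXiv:2509.24060 — 2 statements merged into one kernel-verified Lean document; each statement's English description precedes it below -/
import Mathlib

section
/- For the free Lie algebra g = Lie(ℤⁿ) (equivalently over ℚ, the free Lie algebra on n generators), the Chen ranks θ_r(g) = rank (g/g'')_r are given by θ_1 = n and θ_r = (r−1)·C(n+r−2, r) for r ≥ 2, where g'' denotes the second derived Lie subalgebra and the grading is by bracket length. -/
open Module

namespace ChenRanks

/-- The size of a family of vectors in `P` which spans `P` modulo `R` and has a dual family of
functionals vanishing on `R` is the dimension of `P / (P ∩ R)`. -/
lemma finrank_quotient_eq_card_of_dual {K V ι : Type*} [Field K] [AddCommGroup V] [Module K V]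
    [Fintype ι] [DecidableEq ι] (P R : Submodule K V) (v : ι → V) (hv : ∀ a, v a ∈ P)
    (hspan : P ≤ Submodule.span K (Set.range v) ⊔ R) (f : ι → V →ₗ[K] K)
    (hfR : ∀ a, ∀ q ∈ R, f a q = 0) (hf : ∀ a b, f a (v b) = if a = b then 1 else 0) :
    finrank K (↥P ⧸ Submodule.comap P.subtype R) = Fintype.card ι := by
  have hsum (c : ι → K) (a : ι) : f a (∑ b, c b • v b) = c a := by
    simp [hf]
  let F : (↥P ⧸ Submodule.comap P.subtype R) →ₗ[K] (ι → K) :=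
    Submodule.liftQ _ ((LinearMap.pi f).comp P.subtype) (by
      intro p hp
      ext a
      exact hfR a _ hp)
  have hF : Function.Bijective F := by
    constructor
    · rw [← LinearMap.ker_eq_bot, LinearMap.ker_eq_bot']
      intro m hm
      obtain ⟨p, rfl⟩ := Submodule.Quotient.mk_surjective _ m
      have hp (a : ι) : f a p = 0 := congrFun hm a
      obtain ⟨y, hy, z, hz, hyz⟩ := Submodule.mem_sup.mp (hspan p.2)
      obtain ⟨c, rfl⟩ := (Submodule.mem_span_range_iff_exists_fun K).mp hy
      have hc (a : ι) : c a = 0 := by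
        rw [← hsum c a, ← hp a, ← hyz, map_add, hfR a z hz, add_zero]
      rw [Submodule.Quotient.mk_eq_zero, Submodule.mem_comap, Submodule.subtype_apply, ← hyz]
      simpa [hc] using hz
    · intro c
      refine ⟨Submodule.Quotient.mk
        ⟨∑ b, c b • v b, Submodule.sum_mem _ fun b _ => P.smul_mem _ (hv b)⟩, ?_⟩
      ext a
      exact hsum c a
  rw [(LinearEquiv.ofBijective F hF).finrank_eq, finrank_fintype_fun_eq_card]

section Counting

lemma multiset_exists_min_cons {α : Type*} [LinearOrder α] (s : Multiset α) (hs : s ≠ 0) :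
    ∃ (j : α) (l : List α), s = j ::ₘ (l : Multiset α) ∧ ∀ a ∈ l, j ≤ a := by
  have h : s.toFinset.Nonempty := by
    obtain ⟨a, ha⟩ := Multiset.exists_mem_of_ne_zero hs
    exact ⟨a, Multiset.mem_toFinset.mpr ha⟩
  have hj : s.toFinset.min' h ∈ s := Multiset.mem_toFinset.mp (Finset.min'_mem _ h)
  refine ⟨s.toFinset.min' h, (s.erase (s.toFinset.min' h)).toList, ?_, fun a ha => ?_⟩
  · rw [Multiset.coe_toList, Multiset.cons_erase hj]
  · exact Finset.min'_le _ _
      (Multiset.mem_toFinset.mpr (Multiset.mem_of_mem_erase (Multiset.mem_toList.mp ha)))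

lemma cons_eq_cons_of_le {α : Type*} [LinearOrder α] {i j : α} {s t : Multiset α}
    (hs : ∀ a ∈ s, i ≤ a) (ht : ∀ a ∈ t, j ≤ a) (h : i ::ₘ s = j ::ₘ t) : i = j ∧ s = t := by
  have hij : i = j := by
    apply le_antisymm
    · rcases Multiset.mem_cons.mp (h ▸ Multiset.mem_cons_self j t : j ∈ i ::ₘ s) with hm | hm
      · exact hm.ge
      · exact hs _ hm
    · rcases Multiset.mem_cons.mp (h ▸ Multiset.mem_cons_self i s : i ∈ j ::ₘ t) with hm | hm
      · exact hm.ge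
      · exact ht _ hm
  subst hij
  exact ⟨rfl, (Multiset.cons_inj_right _).mp h⟩

/-- Pairs `(i, s)` with `s` a multiset of size `k` and `i > min s`. They index the basis
`x^s e_i` of a complement of the boundaries in the Koszul complex. -/
abbrev ChenIndex (n k : ℕ) : Type :=
  {p : Fin n × Sym (Fin n) k // ∃ a ∈ p.2, a < p.1}

lemma card_not_exists_lt (n k : ℕ) :
    Fintype.card {p : Fin n × Sym (Fin n) k // ¬ ∃ a ∈ p.2, a < p.1} =
      Fintype.card (Sym (Fin n) (k + 1)) := by
  refine Fintype.card_of_bijective (f := fun p => p.1.1 ::ₛ p.1.2) ⟨?_, ?_⟩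
  · rintro ⟨⟨i, s⟩, hs⟩ ⟨⟨j, t⟩, ht⟩ h
    push Not at hs ht
    obtain ⟨h1, h2⟩ := cons_eq_cons_of_le (s := (s : Multiset (Fin n))) (t := t) hs ht
      (congrArg Subtype.val h)
    simp only [Subtype.mk.injEq, Prod.mk.injEq]
    exact ⟨h1, Subtype.ext h2⟩
  · intro s
    obtain ⟨j, l, h, hl⟩ := multiset_exists_min_cons (s : Multiset (Fin n)) (by
      intro h0
      have := s.2
      simp_all)
    have hc : Multiset.card (l : Multiset (Fin n)) = k := by
      have hs : Multiset.card (s : Multiset (Fin n)) = k + 1 := s.2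
      have h' := congrArg Multiset.card h
      rw [Multiset.card_cons, hs] at h'
      omega
    refine ⟨⟨(j, ⟨l, hc⟩), ?_⟩, Subtype.ext h.symm⟩
    rintro ⟨a, ha, hlt⟩
    exact absurd (hl a ha) (not_le.mpr hlt)

lemma card_chenIndex (n k : ℕ) :
    Fintype.card (ChenIndex n (k + 1)) = (k + 1) * (n + k).choose (k + 2) := by
  have h := Fintype.card_subtype_compl (fun p : Fin n × Sym (Fin n) (k + 1) => ∃ a ∈ p.2, a < p.1)
  have hle := Fintype.card_subtype_le (fun p : Fin n × Sym (Fin n) (k + 1) => ∃ a ∈ p.2, a < p.1)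
  rw [card_not_exists_lt] at h
  rw [Fintype.card_prod, Sym.card_sym_eq_choose, Fintype.card_fin] at hle
  rw [Fintype.card_prod, Sym.card_sym_eq_choose, Sym.card_sym_eq_choose, Fintype.card_fin] at h
  have e1 : n + (k + 1) - 1 = n + k := by omega
  have e2 : n + (k + 1 + 1) - 1 = n + k + 1 := by omega
  rw [e1] at h hle
  rw [e2, Nat.choose_succ_succ (n + k) (k + 1)] at h
  have h3 := Nat.choose_succ_right_eq (n + k) (k + 1)
  change Fintype.card {p : Fin n × Sym (Fin n) (k + 1) // ∃ a ∈ p.2, a < p.1} = _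
  rcases n with _ | n
  · simp at hle ⊢
    rw [Nat.choose_eq_zero_of_lt (by omega)]
  · rw [show n + 1 + k - (k + 1) = n by omega] at h3
    simp only [Nat.succ_eq_add_one] at *
    rw [show k + 2 = k + 1 + 1 by rfl]
    generalize (n + 1 + k).choose (k + 1) = A at *
    generalize (n + 1 + k).choose (k + 1 + 1) = B at *
    zify [hle] at h h3 ⊢
    linarith

end Counting

section Spanning

variable {Q : Type*} [LieRing Q] [LieAlgebra ℚ Q]

local notation "γ" => LieModule.lowerCentralSeries ℚ Q Q

lemma lie_mem_lcs_succ (k : ℕ) (p : Q) {q : Q} (hq : q ∈ γ k) : ⁅p, q⁆ ∈ γ (k + 1) := by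
  rw [LieModule.lowerCentralSeries_succ]
  exact LieSubmodule.lie_mem_lie (LieSubmodule.mem_top p) hq

lemma lie_mem_lcs_add_two (k : ℕ) {p q : Q} (hp : p ∈ γ 1) (hq : q ∈ γ k) :
    ⁅p, q⁆ ∈ γ (k + 2) := by
  rw [← LieSubmodule.mem_toSubmodule, LieModule.lowerCentralSeries_succ,
    LieSubmodule.lieIdeal_oper_eq_linear_span'] at hp
  induction hp using Submodule.span_induction with
  | mem p hp =>
    obtain ⟨a, -, b, -, rfl⟩ := hp
    rw [lie_lie]
    exact sub_mem (lie_mem_lcs_succ _ _ (lie_mem_lcs_succ _ _ hq))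
      (lie_mem_lcs_succ _ _ (lie_mem_lcs_succ _ _ hq))
  | zero => simp
  | add a b _ _ ha hb => rw [add_lie]; exact add_mem ha hb
  | smul c a _ ha => rw [smul_lie]; exact (γ (k + 2)).smul_mem c ha

lemma top_le_span_sup_lcs_one {X : Set Q} (hX : LieSubalgebra.lieSpan ℚ Q X = ⊤) (q : Q) :
    q ∈ Submodule.span ℚ X ⊔ (γ 1).toSubmodule := by
  have hq : q ∈ LieSubalgebra.lieSpan ℚ Q X := hX ▸ LieSubalgebra.mem_top q
  induction hq using LieSubalgebra.lieSpan_induction with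
  | mem x hx => exact Submodule.mem_sup_left (Submodule.subset_span hx)
  | zero => exact zero_mem _
  | add a b _ _ ha hb => exact add_mem ha hb
  | smul c a _ ha => exact Submodule.smul_mem _ c ha
  | lie a b _ _ ha hb =>
    exact Submodule.mem_sup_right (lie_mem_lcs_succ 0 a (LieSubmodule.mem_top b))

/-- If `X` spans `γ_1` modulo `γ_2` and `G` spans `γ_k` modulo `γ_{k+1}`, then the brackets
`⁅x, g⁆` span `γ_{k+1}` modulo `γ_{k+2}`. -/
lemma lcs_succ_le_sup {X G : Set Q} (hX : LieSubalgebra.lieSpan ℚ Q X = ⊤) (k : ℕ)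
    (hG : (γ k).toSubmodule ≤ Submodule.span ℚ G ⊔ (γ (k + 1)).toSubmodule)
    (hGk : G ⊆ γ k) (T : Submodule ℚ Q) (hT : ∀ x ∈ X, ∀ g ∈ G, ⁅x, g⁆ ∈ T) :
    (γ (k + 1)).toSubmodule ≤ T ⊔ (γ (k + 2)).toSubmodule := by
  have hGk' : Submodule.span ℚ G ≤ (γ k).toSubmodule := Submodule.span_le.mpr hGk
  rw [LieModule.lowerCentralSeries_succ, LieSubmodule.lieIdeal_oper_eq_linear_span',
    Submodule.span_le]
  rintro _ ⟨p, -, q, hq, rfl⟩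
  obtain ⟨g, hg, z, hz, rfl⟩ := Submodule.mem_sup.mp (hG hq)
  obtain ⟨x, hx, y, hy, rfl⟩ := Submodule.mem_sup.mp (top_le_span_sup_lcs_one hX p)
  rw [lie_add, add_lie]
  refine add_mem (add_mem (Submodule.mem_sup_left ?_) (Submodule.mem_sup_right ?_))
    (Submodule.mem_sup_right ?_)
  · induction hx using Submodule.span_induction with
    | mem x hx =>
      clear hq
      induction hg using Submodule.span_induction with
      | mem g hg => exact hT x hx g hg
      | zero => simp
      | add a b _ _ ha hb => rw [lie_add]; exact add_mem ha hb
      | smul c a _ ha => rw [lie_smul]; exact T.smul_mem c ha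
    | zero => simp
    | add a b _ _ ha hb => rw [add_lie]; exact add_mem ha hb
    | smul c a _ ha => rw [smul_lie]; exact T.smul_mem c ha
  · exact lie_mem_lcs_add_two k hy (hGk' hg)
  · exact lie_mem_lcs_succ (k + 1) _ hz

variable {n : ℕ} (x : Fin n → Q)

/-- The iterated bracket `⁅x_{l₁}, ⁅x_{l₂}, …, d⁆⁆`. -/
def iterLie (l : List (Fin n)) (d : Q) : Q := l.foldr (fun k d => ⁅x k, d⁆) d

omit [LieAlgebra ℚ Q] in
lemma iterLie_cons (k : Fin n) (l : List (Fin n)) (d : Q) :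
    iterLie x (k :: l) d = ⁅x k, iterLie x l d⁆ := rfl

omit [LieAlgebra ℚ Q] in
lemma iterLie_sub (l : List (Fin n)) (d e : Q) :
    iterLie x l (d - e) = iterLie x l d - iterLie x l e := by
  induction l with
  | nil => rfl
  | cons k l ih => rw [iterLie_cons, ih, lie_sub, iterLie_cons, iterLie_cons]

lemma iterLie_mem (l : List (Fin n)) {d : Q} (hd : d ∈ γ 1) :
    iterLie x l d ∈ γ (l.length + 1) := by
  induction l with
  | nil => exact hd
  | cons k l ih => exact lie_mem_lcs_succ _ _ ih

lemma iterLie_mem_one (l : List (Fin n)) {d : Q} (hd : d ∈ γ 1) : iterLie x l d ∈ γ 1 :=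
  LieModule.antitone_lowerCentralSeries ℚ Q Q (by omega) (iterLie_mem x l hd)

lemma lie_mem_one (p q : Q) : ⁅p, q⁆ ∈ γ 1 := lie_mem_lcs_succ 0 p (LieSubmodule.mem_top q)

variable (hQ : LieAlgebra.derivedSeries ℚ Q 2 = ⊥)
include hQ

lemma lie_eq_zero_of_metabelian {p q : Q} (hp : p ∈ γ 1) (hq : q ∈ γ 1) : ⁅p, q⁆ = 0 := by
  have h : ⁅p, q⁆ ∈ LieAlgebra.derivedSeries ℚ Q 2 := LieSubmodule.lie_mem_lie hp hq
  rwa [hQ, LieSubmodule.mem_bot] at h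

lemma lie_lie_comm_of_metabelian (p q : Q) {d : Q} (hd : d ∈ γ 1) :
    ⁅p, ⁅q, d⁆⁆ = ⁅q, ⁅p, d⁆⁆ := by
  rw [← sub_eq_zero, ← lie_lie]
  exact lie_eq_zero_of_metabelian hQ (lie_mem_one p q) hd

lemma iterLie_perm {l l' : List (Fin n)} (h : l.Perm l') {d : Q} (hd : d ∈ γ 1) :
    iterLie x l d = iterLie x l' d := by
  induction h with
  | nil => rfl
  | cons k _ ih => rw [iterLie_cons, iterLie_cons, ih]
  | swap a b l =>
    exact lie_lie_comm_of_metabelian hQ _ _ (iterLie_mem_one x l hd)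
  | trans _ _ h1 h2 => exact h1.trans h2

lemma lie_iterLie (k : Fin n) (l : List (Fin n)) {d : Q} (hd : d ∈ γ 1) :
    ⁅x k, iterLie x l d⁆ = iterLie x l ⁅x k, d⁆ := by
  induction l with
  | nil => rfl
  | cons a l ih =>
    rw [iterLie_cons, iterLie_cons, ← ih,
      lie_lie_comm_of_metabelian hQ _ _ (iterLie_mem_one x l hd)]

/-- Left-normed brackets `[x_i, x_j, x_{l₁}, …]` with `j < i` and `j ≤ l` (up to sign). -/
def normedBrackets (k : ℕ) : Set Q :=
  {q | ∃ (l : List (Fin n)) (i j : Fin n), l.length = k ∧ j < i ∧ (∀ a ∈ l, j ≤ a) ∧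
    q = iterLie x l ⁅x j, x i⁆}

lemma lcs_le_normedBrackets (hx : LieSubalgebra.lieSpan ℚ Q (Set.range x) = ⊤) (k : ℕ) :
    (γ (k + 1)).toSubmodule ≤
      Submodule.span ℚ (normedBrackets x k) ⊔ (γ (k + 2)).toSubmodule := by
  induction k with
  | zero =>
    refine lcs_succ_le_sup hx 0 (G := Set.range x) (fun q _ => top_le_span_sup_lcs_one hx q)
      (fun _ _ => LieSubmodule.mem_top _) _ ?_
    rintro _ ⟨i, rfl⟩ _ ⟨j, rfl⟩
    rcases lt_trichotomy i j with h | rfl | h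
    · exact Submodule.subset_span ⟨[], j, i, rfl, h, by simp, rfl⟩
    · simp
    · rw [← lie_skew]
      exact neg_mem (Submodule.subset_span ⟨[], i, j, rfl, h, by simp, rfl⟩)
  | succ k ih =>
    refine lcs_succ_le_sup hx (k + 1) ih ?_ _ ?_
    · rintro _ ⟨l, i, j, rfl, -, -, rfl⟩
      exact iterLie_mem x l (lie_mem_one _ _)
    · rintro _ ⟨a, rfl⟩ _ ⟨l, i, j, rfl, hij, hl, rfl⟩
      rcases le_or_gt j a with ha | ha
      · exact Submodule.subset_span ⟨a :: l, i, j, rfl, hij, by simpa [ha] using hl, rfl⟩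
      · have key : ⁅x a, iterLie x l ⁅x j, x i⁆⁆ =
            iterLie x (j :: l) ⁅x a, x i⁆ - iterLie x (i :: l) ⁅x a, x j⁆ := by
          rw [iterLie_cons, iterLie_cons, lie_iterLie x hQ _ _ (lie_mem_one _ _),
            lie_iterLie x hQ _ _ (lie_mem_one _ _), lie_iterLie x hQ _ _ (lie_mem_one _ _),
            ← iterLie_sub, leibniz_lie (x a) (x j) (x i), ← lie_skew (x i) ⁅x a, x j⁆]
          congr 1
          abel
        have hla : ∀ b ∈ l, a ≤ b := fun b hb => ha.le.trans (hl b hb)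
        rw [key]
        refine sub_mem
          (Submodule.subset_span ⟨j :: l, i, a, rfl, ha.trans hij, ?_, rfl⟩)
          (Submodule.subset_span ⟨i :: l, j, a, rfl, ha, ?_, rfl⟩)
        · simpa [ha.le] using hla
        · simpa [(ha.trans hij).le] using hla

end Spanning

section Magnus

open MvPolynomial

/-- The metabelian Lie algebra `ℚⁿ ⋉ Sⁿ`, where `S` is the polynomial ring in `n` variables and
the standard basis vector `e_i` of the abelian Lie algebra `ℚⁿ` acts on `Sⁿ` as multiplication
by `X_i`. -/
def Magnus (n : ℕ) : Type := (Fin n → ℚ) × (Fin n → MvPolynomial (Fin n) ℚ)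

variable {n : ℕ}

noncomputable instance : AddCommGroup (Magnus n) :=
  inferInstanceAs (AddCommGroup ((Fin n → ℚ) × (Fin n → MvPolynomial (Fin n) ℚ)))

noncomputable instance : Module ℚ (Magnus n) :=
  inferInstanceAs (Module ℚ ((Fin n → ℚ) × (Fin n → MvPolynomial (Fin n) ℚ)))

/-- The linear form with the given coefficients. -/
noncomputable def linearForm : (Fin n → ℚ) →ₗ[ℚ] MvPolynomial (Fin n) ℚ :=
  Fintype.linearCombination ℚ X

lemma linearForm_single (i : Fin n) : linearForm (Pi.single i 1) = X i := by
  simp [linearForm, Fintype.linearCombination_apply_single]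

lemma linearForm_mem (a : Fin n → ℚ) : linearForm a ∈ idealOfVars (Fin n) ℚ := by
  rw [linearForm, Fintype.linearCombination_apply]
  exact Submodule.sum_mem _ fun i _ => Submodule.smul_of_tower_mem _ _
    (Ideal.subset_span ⟨i, rfl⟩)

noncomputable instance : Bracket (Magnus n) (Magnus n) :=
  ⟨fun p q => ((0, fun i => linearForm p.1 * q.2 i - linearForm q.1 * p.2 i) :
    (Fin n → ℚ) × (Fin n → MvPolynomial (Fin n) ℚ))⟩

namespace Magnus

/-- The projection to `ℚⁿ`. -/
noncomputable def fstₗ : Magnus n →ₗ[ℚ] (Fin n → ℚ) := LinearMap.fst ℚ _ _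

/-- The projection to `Sⁿ`. -/
noncomputable def sndₗ : Magnus n →ₗ[ℚ] (Fin n → MvPolynomial (Fin n) ℚ) := LinearMap.snd ℚ _ _

lemma ext' {p q : Magnus n} (h1 : fstₗ p = fstₗ q) (h2 : ∀ i, sndₗ p i = sndₗ q i) : p = q :=
  Prod.ext h1 (funext h2)

lemma fst_lie (p q : Magnus n) : fstₗ ⁅p, q⁆ = 0 := rfl

lemma snd_lie (p q : Magnus n) (i : Fin n) :
    sndₗ ⁅p, q⁆ i = linearForm (fstₗ p) * sndₗ q i - linearForm (fstₗ q) * sndₗ p i := rfl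

noncomputable instance : LieRing (Magnus n) where
  add_lie p q r := ext' (by simp [fst_lie]) fun i => by
    simp only [snd_lie, map_add, Pi.add_apply]; ring
  lie_add p q r := ext' (by simp [fst_lie]) fun i => by
    simp only [snd_lie, map_add, Pi.add_apply]; ring
  lie_self p := ext' (by simp [fst_lie]) fun i => by
    simp only [snd_lie, map_zero, Pi.zero_apply]; ring
  leibniz_lie p q r := ext' (by simp [fst_lie]) fun i => by
    simp only [snd_lie, fst_lie, map_add, Pi.add_apply, map_zero]; ring

noncomputable instance : LieAlgebra ℚ (Magnus n) where
  lie_smul c p q := ext' (by simp [fst_lie]) fun i => by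
    simp only [snd_lie, map_smul, Pi.smul_apply, smul_sub, smul_mul_assoc, mul_smul_comm]

/-- The images `(e_i, e_i)` of the generators under the Magnus embedding. -/
noncomputable def gen (i : Fin n) : Magnus n :=
  ((Pi.single i 1, Pi.single i 1) : (Fin n → ℚ) × (Fin n → MvPolynomial (Fin n) ℚ))

lemma fst_gen (i : Fin n) : fstₗ (gen i) = Pi.single i 1 := rfl

lemma snd_gen (i : Fin n) : sndₗ (gen i) = Pi.single i 1 := rfl

lemma derivedSeries_two : LieAlgebra.derivedSeries ℚ (Magnus n) 2 = ⊥ := by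
  have h1 : ∀ p ∈ LieAlgebra.derivedSeries ℚ (Magnus n) 1, fstₗ p = 0 := by
    intro p hp
    rw [LieAlgebra.derivedSeries_def, LieAlgebra.derivedSeriesOfIdeal_succ,
      ← LieSubmodule.mem_toSubmodule, LieSubmodule.lieIdeal_oper_eq_linear_span'] at hp
    induction hp using Submodule.span_induction with
    | mem p hp => obtain ⟨a, -, b, -, rfl⟩ := hp; exact fst_lie a b
    | zero => simp
    | add a b _ _ ha hb => rw [map_add, ha, hb, add_zero]
    | smul c a _ ha => rw [map_smul, ha, smul_zero]
  rw [LieAlgebra.derivedSeries_def, LieAlgebra.derivedSeriesOfIdeal_succ,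
    LieSubmodule.lie_eq_bot_iff]
  intro p hp q hq
  exact ext' (by simp [fst_lie]) fun i => by simp [snd_lie, h1 p hp, h1 q hq]

variable {Q : Type*} [LieRing Q] [LieAlgebra ℚ Q] (g : Q →ₗ⁅ℚ⁆ Magnus n)

lemma map_lcs (k : ℕ) {q : Q} (hq : q ∈ LieModule.lowerCentralSeries ℚ Q Q (k + 1)) :
    fstₗ (g q) = 0 ∧ ∀ i, sndₗ (g q) i ∈ idealOfVars (Fin n) ℚ ^ (k + 1) := by
  induction k generalizing q with
  | zero =>
    rw [LieModule.lowerCentralSeries_succ,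
      ← LieSubmodule.mem_toSubmodule, LieSubmodule.lieIdeal_oper_eq_linear_span'] at hq
    induction hq using Submodule.span_induction with
    | mem p hp =>
      obtain ⟨a, -, b, -, rfl⟩ := hp
      rw [LieHom.map_lie, zero_add, pow_one]
      refine ⟨fst_lie _ _, fun i => ?_⟩
      rw [snd_lie]
      exact sub_mem (Ideal.mul_mem_right _ _ (linearForm_mem _))
        (Ideal.mul_mem_right _ _ (linearForm_mem _))
    | zero => simp
    | add a b _ _ ha hb =>
      simp only [map_add, ha.1, hb.1, Pi.add_apply]
      exact ⟨add_zero _, fun i => add_mem (ha.2 i) (hb.2 i)⟩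
    | smul c a _ ha =>
      simp only [map_smul, ha.1, Pi.smul_apply]
      exact ⟨smul_zero _, fun i => Submodule.smul_of_tower_mem _ _ (ha.2 i)⟩
  | succ k ih =>
    rw [LieModule.lowerCentralSeries_succ,
      ← LieSubmodule.mem_toSubmodule, LieSubmodule.lieIdeal_oper_eq_linear_span'] at hq
    induction hq using Submodule.span_induction with
    | mem p hp =>
      obtain ⟨a, -, b, hb, rfl⟩ := hp
      rw [LieHom.map_lie]
      refine ⟨fst_lie _ _, fun i => ?_⟩
      rw [snd_lie, (ih hb).1, map_zero, zero_mul, sub_zero, pow_succ']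
      exact Ideal.mul_mem_mul (linearForm_mem _) ((ih hb).2 i)
    | zero => simp
    | add a b _ _ ha hb =>
      simp only [map_add, ha.1, hb.1, Pi.add_apply]
      exact ⟨add_zero _, fun i => add_mem (ha.2 i) (hb.2 i)⟩
    | smul c a _ ha =>
      simp only [map_smul, ha.1, Pi.smul_apply]
      exact ⟨smul_zero _, fun i => Submodule.smul_of_tower_mem _ _ (ha.2 i)⟩

variable {x : Fin n → Q} (hg : ∀ i, g (x i) = gen i)
include hg

lemma map_iterLie (l : List (Fin n)) {d : Q} (hd : fstₗ (g d) = 0) :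
    fstₗ (g (iterLie x l d)) = 0 ∧ ∀ i, sndₗ (g (iterLie x l d)) i =
      monomial (Multiset.toFinsupp (l : Multiset (Fin n))) 1 * sndₗ (g d) i := by
  induction l with
  | nil => exact ⟨hd, fun i => by simp [iterLie]⟩
  | cons k l ih =>
    rw [iterLie_cons, LieHom.map_lie, hg]
    refine ⟨fst_lie _ _, fun i => ?_⟩
    rw [snd_lie, ih.1, ih.2, fst_gen, linearForm_single, map_zero, zero_mul, sub_zero, ← mul_assoc,
      X, monomial_mul, one_mul, ← Multiset.cons_coe, ← Multiset.singleton_add, map_add,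
      Multiset.toFinsupp_singleton]

lemma coeff_map_iterLie (s : Multiset (Fin n)) (a : Fin n) (l : List (Fin n)) (i j : Fin n) :
    coeff (Multiset.toFinsupp s) (sndₗ (g (iterLie x l ⁅x j, x i⁆)) a) =
      (if a = i ∧ s = j ::ₘ l then 1 else 0) - (if a = j ∧ s = i ::ₘ l then 1 else 0) := by
  have hd : fstₗ (g ⁅x j, x i⁆) = 0 := by rw [LieHom.map_lie]; exact fst_lie _ _
  have hmon (c : Fin n) (b : Fin n) :
      coeff (Multiset.toFinsupp s) (monomial (Multiset.toFinsupp (l : Multiset (Fin n))) 1 *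
        (X c * (Pi.single b 1 : Fin n → MvPolynomial (Fin n) ℚ) a)) =
      if a = b ∧ s = c ::ₘ l then (1 : ℚ) else 0 := by
    by_cases hab : a = b
    · subst hab
      rw [Pi.single_eq_same, mul_one, X, monomial_mul, ← Multiset.toFinsupp_singleton, ← map_add,
        one_mul, coeff_monomial, add_comm, Multiset.singleton_add]
      simp [eq_comm]
    · simp [hab]
  rw [(map_iterLie g hg l hd).2, LieHom.map_lie, snd_lie, hg, hg, fst_gen, fst_gen, snd_gen,
    snd_gen, linearForm_single, linearForm_single, mul_sub, coeff_sub, hmon, hmon]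

end Magnus

end Magnus

section Main

open Magnus

variable {Q : Type*} [LieRing Q] [LieAlgebra ℚ Q] {n : ℕ} {x : Fin n → Q} (g : Q →ₗ⁅ℚ⁆ Magnus n)
  (hx : LieSubalgebra.lieSpan ℚ Q (Set.range x) = ⊤) (hg : ∀ i, g (x i) = gen i)
include hx hg

local notation "γ" => LieModule.lowerCentralSeries ℚ Q Q

lemma finrank_lcs_zero :
    finrank ℚ (↥(γ 0).toSubmodule ⧸
      Submodule.comap (γ 0).toSubmodule.subtype (γ 1).toSubmodule) = n := by
  rw [finrank_quotient_eq_card_of_dual (γ 0).toSubmodule (γ 1).toSubmodule x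
    (fun _ => LieSubmodule.mem_top _) (fun q _ => top_le_span_sup_lcs_one hx q)
    (fun i => LinearMap.proj i ∘ₗ fstₗ ∘ₗ (g : Q →ₗ[ℚ] Magnus n)), Fintype.card_fin]
  · intro i q hq
    simp [(map_lcs g 0 hq).1]
  · intro i j
    simp [hg, fst_gen, Pi.single_apply]

lemma finrank_lcs_succ (hQ : LieAlgebra.derivedSeries ℚ Q 2 = ⊥) (k : ℕ) :
    finrank ℚ (↥(γ (k + 1)).toSubmodule ⧸
      Submodule.comap (γ (k + 1)).toSubmodule.subtype (γ (k + 2)).toSubmodule) =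
      (k + 1) * (n + k).choose (k + 2) := by
  have hmin (p : ChenIndex n (k + 1)) : ∃ (j : Fin n) (l : List (Fin n)),
      (p.1.2 : Multiset (Fin n)) = j ::ₘ l ∧ ∀ a ∈ l, j ≤ a := by
    refine multiset_exists_min_cons _ fun h => ?_
    have := p.1.2.2
    simp_all
  choose j l hjl hle using hmin
  have hlen (p : ChenIndex n (k + 1)) : (l p).length = k := by
    have h1 : Multiset.card (p.1.2 : Multiset (Fin n)) = k + 1 := p.1.2.2
    have h2 := congrArg Multiset.card (hjl p)
    rw [Multiset.card_cons, Multiset.coe_card, h1] at h2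
    omega
  have hlt (p : ChenIndex n (k + 1)) : j p < p.1.1 := by
    obtain ⟨a, ha, hai⟩ := p.2
    rw [← Sym.mem_coe, hjl p, Multiset.mem_cons] at ha
    rcases ha with rfl | ha
    · exact hai
    · exact (hle p a ha).trans_lt hai
  rw [← card_chenIndex]
  refine finrank_quotient_eq_card_of_dual _ _
    (fun p : ChenIndex n (k + 1) => iterLie x (l p) ⁅x (j p), x p.1.1⁆) (fun p => ?_)
    ((lcs_le_normedBrackets x hQ hx k).trans (sup_le_sup_right (Submodule.span_mono ?_) _))
    (fun p => MvPolynomial.lcoeff ℚ (Multiset.toFinsupp (p.1.2 : Multiset (Fin n))) ∘ₗ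
      LinearMap.proj p.1.1 ∘ₗ sndₗ ∘ₗ (g : Q →ₗ[ℚ] Magnus n)) ?_ ?_
  · have := iterLie_mem x (l p) (lie_mem_one (x (j p)) (x p.1.1))
    rwa [hlen p] at this
  · rintro _ ⟨m, i, b, hm, hbi, hbm, rfl⟩
    let p : ChenIndex n (k + 1) :=
      ⟨(i, ⟨b ::ₘ m, by simp [hm]⟩), ⟨b, Multiset.mem_cons_self b (m : Multiset (Fin n)), hbi⟩⟩
    obtain ⟨h1, h2⟩ := cons_eq_cons_of_le (s := (m : Multiset (Fin n))) (t := l p) hbm (hle p)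
      (hjl p)
    refine ⟨p, ?_⟩
    change iterLie x (l p) ⁅x (j p), x i⁆ = _
    rw [← h1]
    exact iterLie_perm x hQ (Multiset.coe_eq_coe.mp h2.symm) (lie_mem_one _ _)
  · intro p q hq
    refine (MvPolynomial.mem_pow_idealOfVars_iff' _ _).mp ((map_lcs g (k + 1) hq).2 p.1.1) _ ?_
    have hdeg : Finsupp.degree (Multiset.toFinsupp (p.1.2 : Multiset (Fin n))) = k + 1 :=
      (Multiset.toFinsupp_sum_eq _).trans p.1.2.2
    rw [hdeg]
    exact Nat.lt_succ_self _
  · intro p q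
    refine (coeff_map_iterLie g hg _ _ _ _ _).trans ?_
    rw [← hjl q, if_neg (c := _ ∧ _ = q.1.1 ::ₘ _), sub_zero]
    · simp only [Subtype.ext_iff, Prod.ext_iff, Sym.coe_inj]
    · rintro ⟨h1, h2⟩
      obtain ⟨a, ha, hai⟩ := p.2
      rw [← Sym.mem_coe, h2, Multiset.mem_cons] at ha
      rw [h1] at hai
      rcases ha with rfl | ha
      · exact absurd (hlt q) (not_lt.mpr hai.le)
      · exact absurd (hle q a ha) (not_le.mpr hai)

end Main

lemma lieSpan_range_of (R X : Type*) [CommRing R] :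
    LieSubalgebra.lieSpan R (FreeLieAlgebra R X) (Set.range (FreeLieAlgebra.of R)) = ⊤ := by
  set K := LieSubalgebra.lieSpan R (FreeLieAlgebra R X) (Set.range (FreeLieAlgebra.of R))
  let F : FreeLieAlgebra R X →ₗ⁅R⁆ K := FreeLieAlgebra.lift R
    fun i => ⟨FreeLieAlgebra.of R i, LieSubalgebra.subset_lieSpan ⟨i, rfl⟩⟩
  have hF : K.incl.comp F = LieHom.id := FreeLieAlgebra.hom_ext fun i => by
    simp [F]
  rw [eq_top_iff]
  intro q _
  have hq : K.incl (F q) = q := LieHom.congr_fun hF q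
  rw [← hq]
  exact (F q).2

/-- The quotient map of a Lie algebra by an ideal, as a homomorphism of Lie algebras. -/
def quotientMk {R L : Type*} [CommRing R] [LieRing L] [LieAlgebra R L] (I : LieIdeal R L) :
    L →ₗ⁅R⁆ L ⧸ I where
  toLinearMap := I.toSubmodule.mkQ
  map_lie' := rfl

/-- A homomorphism of Lie algebras vanishing on an ideal descends to the quotient. -/
def quotientLift {R L L' : Type*} [CommRing R] [LieRing L] [LieAlgebra R L] [LieRing L']
    [LieAlgebra R L'] (I : LieIdeal R L) (f : L →ₗ⁅R⁆ L') (h : ∀ q ∈ I, f q = 0) :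
    L ⧸ I →ₗ⁅R⁆ L' where
  toLinearMap := I.toSubmodule.liftQ (f : L →ₗ[R] L') h
  map_lie' {p q} := by
    obtain ⟨p, rfl⟩ := Submodule.Quotient.mk_surjective _ p
    obtain ⟨q, rfl⟩ := Submodule.Quotient.mk_surjective _ q
    exact f.map_lie p q

lemma quotientMk_surjective {R L : Type*} [CommRing R] [LieRing L] [LieAlgebra R L]
    (I : LieIdeal R L) : Function.Surjective (quotientMk I) :=
  Submodule.Quotient.mk_surjective _

lemma derivedSeries_quotient (R L : Type*) [CommRing R] [LieRing L] [LieAlgebra R L] (k : ℕ) :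
    LieAlgebra.derivedSeries R (L ⧸ LieAlgebra.derivedSeries R L k) k = ⊥ := by
  rw [← LieIdeal.derivedSeries_map_eq k (quotientMk_surjective _), LieIdeal.map_eq_bot_iff]
  intro q hq
  exact (LieSubmodule.Quotient.mk_eq_zero' (N := LieAlgebra.derivedSeries R L k)).mpr hq

end ChenRanks

/-- For the free Lie algebra `g` on `n` generators (over `ℚ`), graded by
bracket length, the Chen ranks `θ_r = rank (g/g'')_r` are `θ_1 = n` and
`θ_r = (r-1)·C(n+r-2, r)` for `r ≥ 2`.  Since `g/g''` is generated in degree `1`, its `r`-th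
graded piece is `γ_r/γ_{r+1}` of the lower central series of `g/g''`. -/
theorem chen_ranks_free_lie_algebra (n : ℕ) :
    let L := FreeLieAlgebra ℚ (Fin n)
    let I : LieIdeal ℚ L := LieAlgebra.derivedSeries ℚ L 2
    let Q := L ⧸ I
    -- `γ_r` of `Q`; note `lowerCentralSeries … 0 = ⊤ = γ_1`
    let N : ℕ → Submodule ℚ Q := fun j => (LieModule.lowerCentralSeries ℚ Q Q j).toSubmodule
    -- `θ_r = dim (γ_r / γ_{r+1})`
    let θ : ℕ → ℕ := fun r =>
      finrank ℚ (↥(N (r - 1)) ⧸ Submodule.comap (N (r - 1)).subtype (N r))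
    θ 1 = n ∧ ∀ r : ℕ, 2 ≤ r → θ r = (r - 1) * (n + r - 2).choose r := by
  intro L I Q N θ
  let x : Fin n → Q := fun i => ChenRanks.quotientMk I (FreeLieAlgebra.of ℚ i)
  have hx : LieSubalgebra.lieSpan ℚ Q (Set.range x) = ⊤ := by
    have h := LieSubalgebra.map_lieSpan (ChenRanks.quotientMk I)
      (s := Set.range (FreeLieAlgebra.of ℚ (X := Fin n)))
    rw [ChenRanks.lieSpan_range_of, ← Set.range_comp] at h
    rw [eq_top_iff]
    intro q _
    obtain ⟨p, rfl⟩ := ChenRanks.quotientMk_surjective I q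
    exact h ▸ ⟨p, LieSubalgebra.mem_top p, rfl⟩
  have hQ : LieAlgebra.derivedSeries ℚ Q 2 = ⊥ := ChenRanks.derivedSeries_quotient ℚ L 2
  let f : L →ₗ⁅ℚ⁆ ChenRanks.Magnus n := FreeLieAlgebra.lift ℚ ChenRanks.Magnus.gen
  have hf : ∀ q ∈ I, f q = 0 := by
    intro q hq
    have h := LieIdeal.derivedSeries_map_le (f := f) 2 (LieIdeal.mem_map hq)
    rwa [ChenRanks.Magnus.derivedSeries_two, LieSubmodule.mem_bot] at h
  have hg (i : Fin n) : ChenRanks.quotientLift I f hf (x i) = ChenRanks.Magnus.gen i :=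
    FreeLieAlgebra.lift_of_apply _ i
  refine ⟨ChenRanks.finrank_lcs_zero _ hx hg, fun r hr => ?_⟩
  obtain ⟨k, rfl⟩ := Nat.exists_eq_add_of_le' hr
  exact ChenRanks.finrank_lcs_succ _ hx hg hQ k
end

section
/- Let A be a Koszul algebra over a field k, connected and of finite type, and A^! its quadratic dual. Then the Hilbert series satisfy Hilb(A, t) · Hilb(A^!, −t) = 1. -/
noncomputable section

open Module

variable {k : Type*} [Field k]

/-- Tensor powers of the vector space `V = k^m`, in coordinates:
`V^{⊗n} = ((Fin n → Fin m) → k)`. -/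
abbrev TPow (k : Type*) [Field k] (m n : ℕ) : Type _ := (Fin n → Fin m) → k

/-- The subspace `V^{⊗a} ⊗ W ⊗ V^{⊗(n-a-2)}` of `V^{⊗n}`, for a space of quadratic
relations `W ⊆ V ⊗ V`, described in coordinates by the condition that all slices at the
positions `a, a+1` lie in `W`. -/
def posRel {m : ℕ} (W : Submodule k (TPow k m 2)) (n a : ℕ) (ha : a + 2 ≤ n) :
    Submodule k (TPow k m n) where
  carrier := {f | ∀ (x : Fin a → Fin m) (z : Fin (n - (a + 2)) → Fin m),
    (fun p : Fin 2 → Fin m =>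
      f fun i => Fin.append (Fin.append x p) z (Fin.cast (Nat.add_sub_cancel' ha).symm i)) ∈ W}
  add_mem' hf hg x z := W.add_mem (hf x z) (hg x z)
  zero_mem' x z := W.zero_mem
  smul_mem' c f hf x z := W.smul_mem c (hf x z)

/-- The degree-`n` homogeneous part of the quadratic ideal generated by `W`. -/
def quadIdealPiece {m : ℕ} (W : Submodule k (TPow k m 2)) (n : ℕ) :
    Submodule k (TPow k m n) :=
  ⨆ (a : ℕ) (ha : a + 2 ≤ n), posRel W n a ha

/-- The orthogonal complement `W^⊥ ⊆ V^* ⊗ V^*` of a space of quadratic relations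
`W ⊆ V ⊗ V`, in coordinates (identifying `V^*` with `V` via the dual basis). -/
def relPerp {m : ℕ} (W : Submodule k (TPow k m 2)) : Submodule k (TPow k m 2) where
  carrier := {g | ∀ f ∈ W, ∑ K : Fin 2 → Fin m, f K * g K = 0}
  add_mem' {g h} hg hh f hf := by
    have h1 := hg f hf
    have h2 := hh f hf
    simp only [Pi.add_apply, mul_add, Finset.sum_add_distrib, h1, h2, add_zero]
  zero_mem' f hf := by simp
  smul_mem' c g hg f hf := by
    have h1 := hg f hf
    simp only [Pi.smul_apply, smul_eq_mul]
    calc ∑ K : Fin 2 → Fin m, f K * (c * g K) = c * ∑ K : Fin 2 → Fin m, f K * g K := by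
          rw [Finset.mul_sum]; exact Finset.sum_congr rfl fun K _ => by ring
      _ = 0 := by rw [h1, mul_zero]

/-! ### Orthogonal complements for the dot product -/

/-- The orthogonal complement with respect to the standard dot product on `ι → k`. -/
def dotPerp {ι : Type*} [Fintype ι] (P : Submodule k (ι → k)) : Submodule k (ι → k) :=
  LinearMap.BilinForm.orthogonal (dotProductBilin k k) P

lemma mem_dotPerp {ι : Type*} [Fintype ι] {P : Submodule k (ι → k)} {g : ι → k} :
    g ∈ dotPerp P ↔ ∀ f ∈ P, ∑ i, f i * g i = 0 :=
  Iff.rfl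

lemma dotProductBilin_isRefl {ι : Type*} [Fintype ι] :
    (dotProductBilin k k : LinearMap.BilinForm k (ι → k)).IsRefl := fun x y h => by
  change y ⬝ᵥ x = 0
  rw [dotProduct_comm]
  exact h

lemma dotProductBilin_nondegenerate {ι : Type*} [Fintype ι] :
    (dotProductBilin k k : LinearMap.BilinForm k (ι → k)).Nondegenerate := by
  refine ⟨fun x h => dotProduct_eq_zero x h, fun x h => dotProduct_eq_zero x fun y => ?_⟩
  rw [dotProduct_comm]
  exact h y

lemma finrank_dotPerp {ι : Type*} [Fintype ι] (P : Submodule k (ι → k)) :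
    finrank k (dotPerp P) = finrank k ((ι → k) ⧸ P) := by
  have h : finrank k (dotPerp P) = finrank k (ι → k) - finrank k P :=
    LinearMap.BilinForm.finrank_orthogonal dotProductBilin_nondegenerate P
  rw [h, ← P.finrank_quotient_add_finrank, Nat.add_sub_cancel]

lemma dotPerp_dotPerp {ι : Type*} [Fintype ι] (P : Submodule k (ι → k)) :
    dotPerp (dotPerp P) = P :=
  LinearMap.BilinForm.orthogonal_orthogonal (B := dotProductBilin k k)
    dotProductBilin_nondegenerate dotProductBilin_isRefl P

lemma dotPerp_iSup {ι : Type*} [Fintype ι] {α : Sort*} (P : α → Submodule k (ι → k)) :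
    dotPerp (⨆ a, P a) = ⨅ a, dotPerp (P a) := by
  refine le_antisymm (le_iInf fun a g hg f hf => hg f (Submodule.mem_iSup_of_mem a hf)) ?_
  intro g hg
  have h : (⨆ a, P a) ≤ dotPerp (Submodule.span k {g}) := by
    refine iSup_le fun a f hf => ?_
    intro x hx
    obtain ⟨c, rfl⟩ := Submodule.mem_span_singleton.1 hx
    have h0 : f ⬝ᵥ g = 0 := (Submodule.mem_iInf _).1 hg a f hf
    change (c • g) ⬝ᵥ f = 0
    rw [smul_dotProduct, dotProduct_comm, h0, smul_zero]
  intro f hf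
  exact dotProductBilin_isRefl _ _ (h hf g (Submodule.mem_span_singleton_self g))

lemma relPerp_eq_dotPerp {m : ℕ} (W : Submodule k (TPow k m 2)) : relPerp W = dotPerp W :=
  rfl

/-- If `g` is orthogonal to every function all of whose slices lie in `W`, then all slices of
`g` are orthogonal to `W`, and conversely. -/
lemma forall_sum_mul_eq_zero_iff_slices {ι σ κ : Type*} [Fintype ι] [Fintype σ] [Fintype κ]
    (e : σ × κ ≃ ι) (W : Submodule k (κ → k)) (g : ι → k) :
    (∀ f : ι → k, (∀ s, (fun p => f (e (s, p))) ∈ W) → ∑ i, f i * g i = 0) ↔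
      ∀ s, (fun p => g (e (s, p))) ∈ dotPerp W := by
  classical
  constructor
  · intro h s w hw
    have h1 := h (fun i => if (e.symm i).1 = s then w (e.symm i).2 else 0) (fun s' => by
      by_cases hs : s' = s
      · simpa [hs] using hw
      · simp only [Equiv.symm_apply_apply, if_neg hs]
        exact W.zero_mem)
    rw [← e.sum_comp, Fintype.sum_prod_type] at h1
    change ∑ p, w p * g (e (s, p)) = 0
    rw [← h1, Fintype.sum_eq_single s]
    · simp
    · intro s' hs
      simp [hs]
  · intro h f hf
    rw [← e.sum_comp, Fintype.sum_prod_type]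
    exact Finset.sum_eq_zero fun s _ => h s _ (hf s)

/-- Splitting a multi-index of length `n` into its entries at the positions `a, a + 1` and the
remaining ones. -/
def sliceEquiv (m n a : ℕ) (ha : a + 2 ≤ n) :
    ((Fin a → Fin m) × (Fin (n - (a + 2)) → Fin m)) × (Fin 2 → Fin m) ≃ (Fin n → Fin m) where
  toFun q i := Fin.append (Fin.append q.1.1 q.2) q.1.2 (Fin.cast (Nat.add_sub_cancel' ha).symm i)
  invFun u := ((fun i => u ⟨i, by omega⟩, fun i => u ⟨a + 2 + i, by omega⟩),
    fun i => u ⟨a + i, by omega⟩)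
  left_inv := by
    rintro ⟨⟨x, z⟩, p⟩
    refine Prod.ext (Prod.ext (funext fun i => ?_) (funext fun i => ?_)) (funext fun i => ?_)
    · simp [Fin.append, Fin.addCases, show (i : ℕ) < a + 2 by omega]
    · simp [Fin.append, Fin.addCases]
    · fin_cases i <;> simp [Fin.append, Fin.addCases]
  right_inv u := by
    funext i
    simp only [Fin.append, Fin.addCases]
    split_ifs with h1 h2
    · rfl
    · simp only [eq_rec_constant]
      congr 1
      ext
      simp at h2 ⊢
      omega
    · simp only [eq_rec_constant]
      congr 1
      ext
      simp at h1 ⊢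
      omega

lemma dotPerp_posRel {m : ℕ} (W : Submodule k (TPow k m 2)) (n a : ℕ) (ha : a + 2 ≤ n) :
    dotPerp (posRel W n a ha) = posRel (relPerp W) n a ha := by
  ext g
  have h := forall_sum_mul_eq_zero_iff_slices (sliceEquiv m n a ha) W g
  constructor
  · intro hg x z
    exact h.1 (fun f hf => hg f fun x z => hf (x, z)) (x, z)
  · intro hg f hf
    exact h.2 (fun s => hg s.1 s.2) f fun s => hf s.1 s.2

/-- The degree-`n` piece of the quadratic dual coalgebra: the intersection of the subspaces
`V^{⊗a} ⊗ W ⊗ V^{⊗(n-a-2)}`. -/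
def dualPiece {m : ℕ} (W : Submodule k (TPow k m 2)) (n : ℕ) : Submodule k (TPow k m n) :=
  ⨅ (a : ℕ) (ha : a + 2 ≤ n), posRel W n a ha

lemma finrank_quotient_quadIdealPiece_relPerp {m : ℕ} (R : Submodule k (TPow k m 2)) (n : ℕ) :
    finrank k (TPow k m n ⧸ quadIdealPiece (relPerp R) n) = finrank k (dualPiece R n) := by
  have h : dotPerp (quadIdealPiece (relPerp R) n) = dualPiece R n := by
    simp only [quadIdealPiece, dualPiece, dotPerp_iSup, dotPerp_posRel, relPerp_eq_dotPerp,
      dotPerp_dotPerp]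
  rw [← finrank_dotPerp, h]

/-! ### Functions of two variables with prescribed rows and columns -/

/-- The functions `X → Y → k` whose columns lie in `P` and whose rows lie in `Q`, i.e. the
subspace `P ⊗ Q` of `(X → k) ⊗ (Y → k)` in coordinates. -/
def rowCol {X Y : Type*} (P : Submodule k (X → k)) (Q : Submodule k (Y → k)) :
    Submodule k (X → Y → k) where
  carrier := {f | (∀ x, f x ∈ Q) ∧ ∀ y, (fun x => f x y) ∈ P}
  add_mem' hf hg := ⟨fun x => Q.add_mem (hf.1 x) (hg.1 x), fun y => P.add_mem (hf.2 y) (hg.2 y)⟩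
  zero_mem' := ⟨fun _ => Q.zero_mem, fun _ => P.zero_mem⟩
  smul_mem' c _ hf := ⟨fun x => Q.smul_mem c (hf.1 x), fun y => P.smul_mem c (hf.2 y)⟩

lemma finrank_rowCol {X Y : Type*} [Fintype X] [Fintype Y] (P : Submodule k (X → k))
    (Q : Submodule k (Y → k)) :
    finrank k (rowCol P Q) = finrank k P * finrank k Q := by
  classical
  let b := finBasis k Q
  obtain ⟨π, hπ⟩ := Q.subtype.exists_leftInverse_of_injective
    (LinearMap.ker_eq_bot.2 Q.injective_subtype)
  have hπ' (q : Q) : π q = q := LinearMap.congr_fun hπ q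
  let φ (l : Fin (finrank k Q)) : (Y → k) →ₗ[k] k := b.coord l ∘ₗ π
  let Φ : (Fin (finrank k Q) → P) →ₗ[k] rowCol P Q :=
    { toFun c := ⟨fun x => ∑ l, (c l : X → k) x • (b l : Y → k),
        fun x => Q.sum_mem fun l _ => Q.smul_mem _ (b l).2, fun y => by
          have : (fun x => (∑ l, (c l : X → k) x • (b l : Y → k)) y) =
              ∑ l, (b l : Y → k) y • (c l : X → k) := by
            ext x
            simp [mul_comm]
          rw [this]
          exact P.sum_mem fun l _ => P.smul_mem _ (c l).2⟩
      map_add' c d := by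
        ext x y
        simp [add_mul, Finset.sum_add_distrib]
      map_smul' r c := by
        ext x y
        simp [Finset.mul_sum, mul_assoc] }
  let Ψ : rowCol P Q →ₗ[k] (Fin (finrank k Q) → P) :=
    { toFun f l := ⟨fun x => φ l (f.1 x), by
        have : (fun x => φ l (f.1 x)) = ∑ y, φ l (Pi.single y 1) • fun x => f.1 x y := by
          ext x
          rw [LinearMap.pi_apply_eq_sum_univ (φ l) (f.1 x)]
          simp only [Finset.sum_apply, Pi.smul_apply, smul_eq_mul]
          refine Finset.sum_congr rfl fun y _ => ?_
          rw [mul_comm]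
          congr 2
          ext y'
          simp [Pi.single_apply, eq_comm]
        rw [this]
        exact P.sum_mem fun y _ => P.smul_mem _ (f.2.2 y)⟩
      map_add' f g := by
        ext l x
        simp
      map_smul' r f := by
        ext l x
        simp }
  have h1 : Φ ∘ₗ Ψ = LinearMap.id := by
    ext f x : 3
    change ∑ l, b.coord l (π (f.1 x)) • (b l : Y → k) = f.1 x
    have h := congrArg Q.subtype (b.sum_repr ⟨f.1 x, f.2.1 x⟩)
    rw [map_sum] at h
    have h2 := hπ' ⟨f.1 x, f.2.1 x⟩
    simp only at h2
    rw [h2]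
    exact h
  have h2 : Ψ ∘ₗ Φ = LinearMap.id := by
    refine LinearMap.ext fun c => ?_
    funext l
    ext x
    change b.coord l (π (∑ l', (c l' : X → k) x • (b l' : Y → k))) = (c l : X → k) x
    rw [map_sum, map_sum, Finset.sum_eq_single l]
    · simp [hπ']
    · intro l' _ hl
      simp [hπ', hl]
    · simp
  rw [(LinearEquiv.ofLinearMap Φ Ψ h1 h2).symm.finrank_eq, Module.finrank_pi_fintype]
  simp [mul_comm]

/-- For a family of functions, taking slicewise membership commutes with suprema. -/
lemma pi_iSup_eq {Y E : Type*} [Finite Y] [AddCommGroup E] [Module k E] {α : Sort*}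
    (P : α → Submodule k E) :
    Submodule.pi Set.univ (fun _ : Y => ⨆ a, P a) =
      ⨆ a, Submodule.pi Set.univ (fun _ : Y => P a) := by
  classical
  have := Fintype.ofFinite Y
  refine le_antisymm (fun g hg => ?_)
    (iSup_le fun a g hg y hy => Submodule.mem_iSup_of_mem a (hg y hy))
  rw [← Finset.univ_sum_single g]
  refine Submodule.sum_mem _ fun y _ => ?_
  have h : Pi.single y (g y) ∈ (⨆ a, P a).map (LinearMap.single k (fun _ : Y => E) y) :=
    ⟨g y, hg y trivial, rfl⟩
  rw [Submodule.map_iSup] at h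
  refine (iSup_mono fun a => ?_ : _ ≤ ⨆ a, Submodule.pi Set.univ (fun _ : Y => P a)) h
  rintro _ ⟨w, hw, rfl⟩ y' -
  by_cases hy : y' = y
  · subst hy
    simpa using hw
  · simp [hy]

/-! ### Slices of `posRel` -/

/-- Replace the entries of `u` at the positions `a, a + 1` by `p`. -/
def replaceAt {m n : ℕ} (a : ℕ) (p : Fin 2 → Fin m) (u : Fin n → Fin m) : Fin n → Fin m :=
  fun i => if (i : ℕ) = a then p 0 else if (i : ℕ) = a + 1 then p 1 else u i

lemma sliceEquiv_eq_replaceAt {m n a : ℕ} (ha : a + 2 ≤ n)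
    (s : (Fin a → Fin m) × (Fin (n - (a + 2)) → Fin m)) (p p' : Fin 2 → Fin m) :
    sliceEquiv m n a ha (s, p) = replaceAt a p (sliceEquiv m n a ha (s, p')) := by
  funext i
  simp only [sliceEquiv, Equiv.coe_fn_mk, replaceAt, Fin.append, Fin.addCases]
  rcases lt_or_ge (i : ℕ) a with h | h
  · simp [h, show (i : ℕ) < a + 2 by omega, show (i : ℕ) ≠ a by omega,
      show (i : ℕ) ≠ a + 1 by omega]
  · rcases lt_or_ge (i : ℕ) (a + 2) with h' | h'
    · have hi : (i : ℕ) = a ∨ (i : ℕ) = a + 1 := by omega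
      rcases hi with hi | hi
      · simp only [hi, Fin.val_cast]
        simp
        rw [dif_neg (not_lt.2 h)]
        refine congrArg p (Fin.ext ?_)
        simp [hi]
      · simp only [hi, Fin.val_cast]
        simp
        rw [dif_neg (not_lt.2 h)]
        refine congrArg p (Fin.ext ?_)
        simp [hi]
    · simp [show ¬ (i : ℕ) < a + 2 by omega, show (i : ℕ) ≠ a by omega,
        show (i : ℕ) ≠ a + 1 by omega]

lemma mem_posRel_iff {m n a : ℕ} {W : Submodule k (TPow k m 2)} (ha : a + 2 ≤ n)
    {f : TPow k m n} :
    f ∈ posRel W n a ha ↔ ∀ u, (fun p => f (replaceAt a p u)) ∈ W := by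
  have h : f ∈ posRel W n a ha ↔ ∀ s, (fun p => f (sliceEquiv m n a ha (s, p))) ∈ W :=
    ⟨fun h s => h s.1 s.2, fun h x z => h (x, z)⟩
  rw [h]
  constructor
  · intro h u
    obtain ⟨⟨s, p'⟩, rfl⟩ := (sliceEquiv m n a ha).surjective u
    simpa only [← sliceEquiv_eq_replaceAt] using h s
  · intro h s
    rcases isEmpty_or_nonempty (Fin 2 → Fin m) with he | ⟨⟨p'⟩⟩
    · rw [Subsingleton.elim (fun p => f (sliceEquiv m n a ha (s, p))) 0]
      exact W.zero_mem
    · simpa only [← sliceEquiv_eq_replaceAt] using h (sliceEquiv m n a ha (s, p'))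

lemma replaceAt_append_left {m i j a : ℕ} (ha : a + 2 ≤ i) (p : Fin 2 → Fin m)
    (x : Fin i → Fin m) (y : Fin j → Fin m) :
    replaceAt a p (Fin.append x y) = Fin.append (replaceAt a p x) y := by
  funext l
  refine Fin.addCases (fun l => ?_) (fun l => ?_) l
  · simp [replaceAt]
  · simp [replaceAt, show i + (l : ℕ) ≠ a by omega, show i + (l : ℕ) ≠ a + 1 by omega]

lemma replaceAt_append_right {m i j a : ℕ} (p : Fin 2 → Fin m)
    (x : Fin i → Fin m) (y : Fin j → Fin m) :
    replaceAt (i + a) p (Fin.append x y) = Fin.append x (replaceAt a p y) := by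
  funext l
  refine Fin.addCases (fun l => ?_) (fun l => ?_) l
  · simp [replaceAt, show (l : ℕ) ≠ i + a by omega, show (l : ℕ) ≠ i + a + 1 by omega]
  · simp [replaceAt, add_assoc]

lemma mem_posRel_left_iff {m i j a : ℕ} {W : Submodule k (TPow k m 2)} (ha : a + 2 ≤ i)
    {f : TPow k m (i + j)} :
    f ∈ posRel W (i + j) a (by omega) ↔
      ∀ y, (fun x => f (Fin.append x y)) ∈ posRel W i a ha := by
  simp only [mem_posRel_iff, ← replaceAt_append_left ha]
  constructor
  · intro h y x
    exact h _
  · intro h u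
    obtain ⟨⟨x, y⟩, rfl⟩ := (Fin.appendEquiv i j).surjective u
    exact h y x

lemma mem_posRel_right_iff {m i j a : ℕ} {W : Submodule k (TPow k m 2)} (ha : a + 2 ≤ j)
    {f : TPow k m (i + j)} :
    f ∈ posRel W (i + j) (i + a) (by omega) ↔
      ∀ x, (fun y => f (Fin.append x y)) ∈ posRel W j a ha := by
  simp only [mem_posRel_iff, ← replaceAt_append_right]
  constructor
  · intro h y x
    exact h _
  · intro h u
    obtain ⟨⟨x, y⟩, rfl⟩ := (Fin.appendEquiv i j).surjective u
    exact h x y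

/-! ### The two filtrations of `V^{⊗n}` -/

/-- The intersection of the relation subspaces at the positions `≥ i`. -/
def infFrom {m : ℕ} (W : Submodule k (TPow k m 2)) (n i : ℕ) : Submodule k (TPow k m n) :=
  ⨅ (a : ℕ) (ha : a + 2 ≤ n) (_ : i ≤ a), posRel W n a ha

/-- The sum of the relation subspaces supported in the first `i` tensor factors. -/
def supUpTo {m : ℕ} (W : Submodule k (TPow k m 2)) (n i : ℕ) : Submodule k (TPow k m n) :=
  ⨆ (a : ℕ) (ha : a + 2 ≤ n) (_ : a + 2 ≤ i), posRel W n a ha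

/-- Functions on multi-indices of length `i + j` as functions of two variables. -/
def curryAppend (k : Type*) [Field k] (m i j : ℕ) :
    TPow k m (i + j) ≃ₗ[k] ((Fin i → Fin m) → (Fin j → Fin m) → k) :=
  (LinearEquiv.funCongrLeft k k (Fin.appendEquiv i j)).trans (LinearEquiv.curry k k _ _)

lemma curryAppend_apply {m i j : ℕ} (f : TPow k m (i + j)) (x : Fin i → Fin m)
    (y : Fin j → Fin m) : curryAppend k m i j f x y = f (Fin.append x y) :=
  rfl

lemma mem_infFrom_iff {m i j : ℕ} {W : Submodule k (TPow k m 2)} {f : TPow k m (i + j)} :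
    f ∈ infFrom W (i + j) i ↔ ∀ x, curryAppend k m i j f x ∈ dualPiece W j := by
  simp only [infFrom, dualPiece, Submodule.mem_iInf]
  constructor
  · intro h x a ha
    exact (mem_posRel_right_iff ha).1 (h (i + a) (by omega) (by omega)) x
  · intro h a ha hia
    obtain ⟨b, rfl⟩ := Nat.exists_eq_add_of_le hia
    exact (mem_posRel_right_iff (by omega)).2 fun x => h x b (by omega)

lemma mem_supUpTo_iff {m i j : ℕ} {W : Submodule k (TPow k m 2)} {f : TPow k m (i + j)} :
    f ∈ supUpTo W (i + j) i ↔
      ∀ y, (fun x => curryAppend k m i j f x y) ∈ quadIdealPiece W i := by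
  let e : TPow k m (i + j) ≃ₗ[k] ((Fin j → Fin m) → TPow k m i) :=
    (LinearEquiv.funCongrLeft k k
      ((Equiv.prodComm _ _).trans (Fin.appendEquiv i j))).trans (LinearEquiv.curry k k _ _)
  have h : supUpTo W (i + j) i =
      (Submodule.pi Set.univ (fun _ : Fin j → Fin m => quadIdealPiece W i)).comap
        e.toLinearMap := by
    rw [quadIdealPiece, pi_iSup_eq]
    simp only [pi_iSup_eq]
    rw [← LinearEquiv.symm_symm e, ← Submodule.map_equiv_eq_comap_symm e.symm, supUpTo]
    simp only [Submodule.map_iSup]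
    refine iSup_congr fun a => ?_
    rw [iSup_comm]
    by_cases ha : a + 2 ≤ i
    · have ha' : a + 2 ≤ i + j := by omega
      simp only [ha, ha', iSup_pos]
      rw [Submodule.map_equiv_eq_comap_symm]
      ext f
      rw [mem_posRel_left_iff ha]
      exact ⟨fun h y _ => h y, fun h y => h y trivial⟩
    · simp [ha]
  rw [h]
  exact ⟨fun h y => h y trivial, fun h y _ => h y⟩

lemma finrank_infFrom {m i j : ℕ} (W : Submodule k (TPow k m 2)) :
    finrank k (infFrom W (i + j) i) = finrank k (TPow k m i) * finrank k (dualPiece W j) := by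
  have h : infFrom W (i + j) i =
      (rowCol ⊤ (dualPiece W j)).comap (curryAppend k m i j).toLinearMap := by
    ext f
    rw [mem_infFrom_iff]
    exact ⟨fun h => ⟨h, fun _ => trivial⟩, fun h => h.1⟩
  rw [h, ((curryAppend k m i j).ofSubmodule' _).finrank_eq, finrank_rowCol, finrank_top]

lemma finrank_infFrom_inf_supUpTo {m i j : ℕ} (W : Submodule k (TPow k m 2)) :
    finrank k (infFrom W (i + j) i ⊓ supUpTo W (i + j) i : Submodule k _) =
      finrank k (quadIdealPiece W i) * finrank k (dualPiece W j) := by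
  have h : infFrom W (i + j) i ⊓ supUpTo W (i + j) i =
      (rowCol (quadIdealPiece W i) (dualPiece W j)).comap
        (curryAppend k m i j).toLinearMap := by
    ext f
    rw [Submodule.mem_inf, mem_infFrom_iff, mem_supUpTo_iff]
    rfl
  rw [h, ((curryAppend k m i j).ofSubmodule' _).finrank_eq, finrank_rowCol]

/-- The dimension of the component `A_i ⊗ (A^!_j)^*` of the Koszul complex. -/
lemma finrank_koszul_component {m i n : ℕ} (hi : i ≤ n) (R : Submodule k (TPow k m 2)) :
    (finrank k (TPow k m i ⧸ quadIdealPiece R i) : ℤ) *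
        finrank k (TPow k m (n - i) ⧸ quadIdealPiece (relPerp R) (n - i)) =
      finrank k (infFrom R n i) -
        finrank k (infFrom R n i ⊓ supUpTo R n i : Submodule k _) := by
  obtain ⟨j, rfl⟩ := Nat.exists_eq_add_of_le hi
  rw [Nat.add_sub_cancel_left, finrank_quotient_quadIdealPiece_relPerp, finrank_infFrom,
    finrank_infFrom_inf_supUpTo, ← (quadIdealPiece R i).finrank_quotient_add_finrank]
  push_cast
  ring

/-! ### Exactness -/

lemma infFrom_eq_inf {m n i : ℕ} (W : Submodule k (TPow k m 2)) (hi : i + 2 ≤ n) :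
    infFrom W n i = infFrom W n (i + 1) ⊓ posRel W n i hi := by
  refine le_antisymm (le_inf ?_ ?_) ?_
  · exact le_iInf fun a => le_iInf fun ha => le_iInf fun hia =>
      iInf_le_of_le a (iInf_le_of_le ha (iInf_le_of_le (by omega) le_rfl))
  · exact iInf_le_of_le i (iInf_le_of_le hi (iInf_le_of_le le_rfl le_rfl))
  · refine le_iInf fun a => le_iInf fun ha => le_iInf fun hia => ?_
    rcases hia.eq_or_lt with rfl | h
    · exact inf_le_right
    · exact inf_le_of_left_le
        (iInf_le_of_le a (iInf_le_of_le ha (iInf_le_of_le h le_rfl)))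

lemma supUpTo_eq_sup {m n i : ℕ} (W : Submodule k (TPow k m 2)) (hi : i + 2 ≤ n) :
    supUpTo W n (i + 2) = supUpTo W n (i + 1) ⊔ posRel W n i hi := by
  refine le_antisymm ?_ (sup_le ?_ ?_)
  · refine iSup_le fun a => iSup_le fun ha => iSup_le fun hia => ?_
    rcases hia.eq_or_lt with h | h
    · obtain rfl : a = i := by omega
      exact le_sup_right
    · exact le_sup_of_le_left
        (le_iSup_of_le a (le_iSup_of_le ha (le_iSup_of_le (by omega) le_rfl)))
  · exact iSup_le fun a => iSup_le fun ha => iSup_le fun hia =>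
      le_iSup_of_le a (le_iSup_of_le ha (le_iSup_of_le (by omega) le_rfl))
  · exact le_iSup_of_le i (le_iSup_of_le hi (le_iSup_of_le le_rfl le_rfl))

lemma infFrom_eq_top {m n i : ℕ} (W : Submodule k (TPow k m 2)) (hi : n < i + 2) :
    infFrom W n i = ⊤ := by
  simp only [infFrom, iInf_eq_top]
  intro a ha hia
  omega

lemma supUpTo_eq_bot {m n i : ℕ} (W : Submodule k (TPow k m 2)) (hi : i < 2) :
    supUpTo W n i = ⊥ := by
  simp only [supUpTo, iSup_eq_bot]
  intro a ha hia
  omega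

lemma supUpTo_succ_self {m n : ℕ} (W : Submodule k (TPow k m 2)) :
    supUpTo W n (n + 1) = supUpTo W n n := by
  refine le_antisymm ?_ ?_ <;>
  exact iSup_le fun a => iSup_le fun ha => iSup_le fun hia =>
      le_iSup_of_le a (le_iSup_of_le ha (le_iSup_of_le (by omega) le_rfl))

lemma infFrom_eq_top_or_mem {m : ℕ} (W : Submodule k (TPow k m 2)) (n i : ℕ) :
    infFrom W n i = ⊤ ∨ infFrom W n i ∈
      latticeClosure {X | ∃ a, ∃ ha : a + 2 ≤ n, X = posRel W n a ha} := by
  rcases lt_or_ge n (i + 2) with h | h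
  · exact Or.inl (infFrom_eq_top W h)
  · refine Or.inr ?_
    have hmem : posRel W n i h ∈
        latticeClosure {X | ∃ a, ∃ ha : a + 2 ≤ n, X = posRel W n a ha} :=
      subset_latticeClosure ⟨i, h, rfl⟩
    rw [infFrom_eq_inf W h]
    rcases infFrom_eq_top_or_mem W n (i + 1) with h1 | h1
    · rwa [h1, top_inf_eq]
    · exact isSublattice_latticeClosure.infClosed h1 hmem
  termination_by n - i

lemma supUpTo_eq_bot_or_mem {m : ℕ} (W : Submodule k (TPow k m 2)) {n i : ℕ}
    (hi : i + 1 ≤ n) :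
    supUpTo W n (i + 1) = ⊥ ∨ supUpTo W n (i + 1) ∈
      latticeClosure {X | ∃ a, ∃ ha : a + 2 ≤ n, X = posRel W n a ha} := by
  induction i with
  | zero => exact Or.inl (supUpTo_eq_bot W (by omega))
  | succ i ih =>
    refine Or.inr ?_
    have hmem : posRel W n i hi ∈
        latticeClosure {X | ∃ a, ∃ ha : a + 2 ≤ n, X = posRel W n a ha} :=
      subset_latticeClosure ⟨i, hi, rfl⟩
    rw [supUpTo_eq_sup W hi]
    rcases ih (by omega) with h1 | h1
    · rwa [h1, bot_sup_eq]
    · exact isSublattice_latticeClosure.supClosed h1 hmem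

/-- Exactness of the Koszul complex, in terms of dimensions. -/
lemma finrank_infFrom_inf_supUpTo_succ {m n i : ℕ} (R : Submodule k (TPow k m 2))
    (hdist : ∀ x ∈ latticeClosure {X | ∃ a, ∃ ha : a + 2 ≤ n, X = posRel R n a ha},
      ∀ y ∈ latticeClosure {X | ∃ a, ∃ ha : a + 2 ≤ n, X = posRel R n a ha},
      ∀ z ∈ latticeClosure {X | ∃ a, ∃ ha : a + 2 ≤ n, X = posRel R n a ha},
      x ⊓ (y ⊔ z) = (x ⊓ y) ⊔ (x ⊓ z)) (hi : i + 2 ≤ n) :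
    finrank k (infFrom R n (i + 1) ⊓ supUpTo R n (i + 2) : Submodule k _) +
        finrank k (infFrom R n i ⊓ supUpTo R n (i + 1) : Submodule k _) =
      finrank k (infFrom R n (i + 1) ⊓ supUpTo R n (i + 1) : Submodule k _) +
        finrank k (infFrom R n i) := by
  have h1 : infFrom R n (i + 1) ⊓ supUpTo R n (i + 2) =
      (infFrom R n (i + 1) ⊓ supUpTo R n (i + 1)) ⊔ infFrom R n i := by
    rw [supUpTo_eq_sup R hi, infFrom_eq_inf R hi]
    rcases infFrom_eq_top_or_mem R n (i + 1) with h | h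
    · simp [h]
    rcases supUpTo_eq_bot_or_mem R (n := n) (i := i) (by omega) with h' | h'
    · simp [h']
    exact hdist _ h _ h' _ (subset_latticeClosure ⟨i, hi, rfl⟩)
  have h2 : infFrom R n i ⊓ supUpTo R n (i + 1) =
      (infFrom R n (i + 1) ⊓ supUpTo R n (i + 1)) ⊓ infFrom R n i := by
    rw [infFrom_eq_inf R hi]
    ac_nf
  rw [h1, h2]
  exact Submodule.finrank_sup_add_finrank_inf_eq _ _

/-- (Koszul duality of Hilbert series.)  Let `A = T(V)/(R)` be a quadratic
algebra on a finite-dimensional vector space `V = k^m`, with quadratic relations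
`R ⊆ V ⊗ V`, and let `A^! = T(V^*)/(R^⊥)` be its quadratic dual; both are connected and of
finite type, with degree-`n` pieces `V^{⊗n}/(∑_a V^{⊗a}⊗R⊗V^{⊗b})` resp. the same with
`R^⊥`.  Assume `A` is Koszul; by Backelin's criterion this means that for every `n` the
subspaces `V^{⊗a} ⊗ R ⊗ V^{⊗b}` generate a distributive sublattice of the lattice of
subspaces of `V^{⊗n}`.  Then `Hilb(A, t) · Hilb(A^!, -t) = 1`. -/
theorem koszul_hilbert_series_duality {m : ℕ}
    (R : Submodule k (TPow k m 2))
    (hkoszul : ∀ n : ℕ,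
      ∀ x ∈ latticeClosure {W : Submodule k (TPow k m n) | ∃ a, ∃ ha : a + 2 ≤ n,
        W = posRel R n a ha},
      ∀ y ∈ latticeClosure {W : Submodule k (TPow k m n) | ∃ a, ∃ ha : a + 2 ≤ n,
        W = posRel R n a ha},
      ∀ z ∈ latticeClosure {W : Submodule k (TPow k m n) | ∃ a, ∃ ha : a + 2 ≤ n,
        W = posRel R n a ha},
      x ⊓ (y ⊔ z) = (x ⊓ y) ⊔ (x ⊓ z)) :
    (PowerSeries.mk fun n =>
        (finrank k (TPow k m n ⧸ quadIdealPiece R n) : ℤ)) *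
      (PowerSeries.mk fun n =>
        ((-1 : ℤ) ^ n * finrank k (TPow k m n ⧸ quadIdealPiece (relPerp R) n))) = 1 := by
  ext n
  rw [PowerSeries.coeff_mul, Finset.Nat.sum_antidiagonal_eq_sum_range_succ_mk]
  simp only [PowerSeries.coeff_mk, PowerSeries.coeff_one]
  let t (i : ℕ) : ℤ := finrank k (infFrom R n i) -
    finrank k (infFrom R n i ⊓ supUpTo R n i : Submodule k _)
  have ht : ∀ i ∈ Finset.range n.succ,
      (finrank k (TPow k m i ⧸ quadIdealPiece R i) : ℤ) * ((-1 : ℤ) ^ (n - i) *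
        finrank k (TPow k m (n - i) ⧸ quadIdealPiece (relPerp R) (n - i))) =
      (-1) ^ (n - i) * t i := by
    intro i hi
    rw [mul_left_comm, finrank_koszul_component (Finset.mem_range_succ_iff.1 hi)]
  rw [Finset.sum_congr rfl ht]
  rcases n with _ | n
  · have h0 : t 0 = 1 := by
      simp only [t]
      rw [infFrom_eq_top R (by omega), supUpTo_eq_bot R (by omega), inf_bot_eq, finrank_top]
      simp
    simp [h0]
  let v (i : ℕ) : ℤ := finrank k (infFrom R (n + 1) i) -
    finrank k (infFrom R (n + 1) i ⊓ supUpTo R (n + 1) (i + 1) : Submodule k _)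
  have hsum : ∀ i ≤ n, ∑ l ∈ Finset.range (i + 1), (-1) ^ (n + 1 - l) * t l =
      (-1) ^ (n + 1 - i) * v i := by
    intro i hi
    induction i with
    | zero =>
      have h0 : t 0 = v 0 := by
        simp only [t, v]
        rw [supUpTo_eq_bot R (i := 0) (by omega), supUpTo_eq_bot R (i := 0 + 1) (by omega)]
      rw [Finset.sum_range_one, h0]
    | succ i ih =>
      have h := finrank_infFrom_inf_supUpTo_succ R (hkoszul (n + 1)) (i := i) (by omega)
      have htv : t (i + 1) = v (i + 1) + v i := by
        simp only [t, v]
        push_cast [← Nat.cast_inj (R := ℤ)] at h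
        linarith
      rw [Finset.sum_range_succ, ih (by omega), htv,
        show n + 1 - i = n + 1 - (i + 1) + 1 by omega, pow_succ]
      ring
  have htop : t (n + 1) = v n := by
    simp only [t, v]
    rw [infFrom_eq_top R (i := n + 1) (by omega), infFrom_eq_top R (i := n) (by omega)]
  rw [Finset.sum_range_succ, hsum n le_rfl, htop]
  simp

end
end
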